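/- arXiv:1909.12649 — 2 statements merged into one kernel-verified Lean document; each statement's English description precedes it below -/
import Mathlib

section
/- The matrix A_n + f(n)·I_n, where f(n) = n(n²-1)/6, is completely positive for every n ≥ 1; moreover f(n) is the smallest such translation, since A_n + α·I_n is not positive semidefinite for α < f(n). -/
open Matrix

/-- `M` is completely positive: `M = B * Bᵀ` for an entrywise nonnegative matrix `B`. -/
def IsCompletelyPositive {ι : Type*} (M : Matrix ι ι ℝ) : Prop :=
  ∃ (k : ℕ) (B : Matrix ι (Fin k) ℝ), (∀ i j, 0 ≤ B i j) ∧ M = B * Bᵀ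

namespace IsCompletelyPositive

variable {ι κ : Type*} {M N : Matrix ι ι ℝ}

theorem mul_transpose [Fintype κ] (B : Matrix ι κ ℝ) (hB : ∀ i j, 0 ≤ B i j) :
    IsCompletelyPositive (B * Bᵀ) := by
  refine ⟨Fintype.card κ, B.submatrix id (Fintype.equivFin κ).symm, fun i j => hB _ _, ?_⟩
  rw [transpose_submatrix, submatrix_mul_equiv, submatrix_id_id]

theorem add (hM : IsCompletelyPositive M) (hN : IsCompletelyPositive N) :
    IsCompletelyPositive (M + N) := by
  obtain ⟨k, B, hB, rfl⟩ := hM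
  obtain ⟨l, C, hC, rfl⟩ := hN
  have h := mul_transpose (fromCols B C) (fun i j => by cases j <;> simp [hB, hC])
  rwa [transpose_fromCols, fromCols_mul_fromRows] at h

theorem submatrix (hM : IsCompletelyPositive M) (e : κ → ι) :
    IsCompletelyPositive (M.submatrix e e) := by
  obtain ⟨k, B, hB, rfl⟩ := hM
  exact ⟨k, B.submatrix e id, fun i j => hB _ _, rfl⟩

theorem diagonal [Fintype ι] [DecidableEq ι] {d : ι → ℝ} (hd : ∀ i, 0 ≤ d i) :
    IsCompletelyPositive (diagonal d) := by
  have h := mul_transpose (Matrix.diagonal fun i => √(d i))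
    (fun i j => by rw [diagonal_apply]; split_ifs <;> positivity)
  simpa [Real.mul_self_sqrt (hd _)] using h

theorem fromBlocks_zero (hM : IsCompletelyPositive M) :
    IsCompletelyPositive (fromBlocks M 0 0 (0 : Matrix κ κ ℝ)) := by
  obtain ⟨k, B, hB, rfl⟩ := hM
  refine ⟨k, fromRows B 0, fun i j => by cases i <;> simp [hB], ?_⟩
  rw [transpose_fromRows, fromRows_mul_fromCols]
  simp

/-- A scaled diagonal dominance criterion for complete positivity. -/
theorem add_diagonal_of_mulVec_le [Fintype ι] [DecidableEq ι] {D : Matrix ι ι ℝ}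
    (hD : ∀ i j, 0 ≤ D i j) (hsymm : D.IsSymm) {h d : ι → ℝ} (hh : ∀ i, 0 < h i)
    (hle : ∀ i, (D *ᵥ h) i ≤ h i * d i) :
    IsCompletelyPositive (D + Matrix.diagonal d) := by
  let B : Matrix ι (ι × ι) ℝ := fun r p =>
    √(D p.1 p.2 / (2 * h p.1 * h p.2)) *
      ((if r = p.1 then h p.2 else 0) + (if r = p.2 then h p.1 else 0))
  have hB : IsCompletelyPositive (B * Bᵀ) := mul_transpose B fun r p => by
    have := (hh p.1).le
    have := (hh p.2).le
    positivity
  have hsplit : D + Matrix.diagonal d =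
      B * Bᵀ + Matrix.diagonal fun i => d i - (D *ᵥ h) i / h i := by
    ext r s
    have hterm : ∀ i j, B r (i, j) * B s (i, j) =
        (if r = i then if s = i then D i j * h j / (2 * h i) else 0 else 0) +
        (if r = i then if s = j then D i j / 2 else 0 else 0) +
        (if s = i then if r = j then D i j / 2 else 0 else 0) +
        (if r = j then if s = j then D i j * h i / (2 * h j) else 0 else 0) := by
      intro i j
      have hi := hh i
      have hj := hh j
      have hsq := Real.mul_self_sqrt
        (div_nonneg (hD i j) (by positivity : 0 ≤ 2 * h i * h j))
      have : B r (i, j) * B s (i, j) = D i j / (2 * h i * h j) *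
          (((if r = i then h j else 0) + (if r = j then h i else 0)) *
            ((if s = i then h j else 0) + (if s = j then h i else 0))) := by
        rw [← hsq]
        simp only [B]
        ring
      rw [this]
      split_ifs <;> field_simp <;> ring
    have hsum : (B * Bᵀ) r s = D r s + if r = s then (D *ᵥ h) r / h r else 0 := by
      rw [mul_apply, Fintype.sum_prod_type]
      simp only [transpose_apply, hterm, Finset.sum_add_distrib]
      have h1 : ∑ i, ∑ j, (if r = i then if s = i then D i j * h j / (2 * h i) else 0 else 0) =
          if r = s then (D *ᵥ h) r / (2 * h r) else 0 := by
        rw [Finset.sum_comm]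
        rcases eq_or_ne r s with rfl | hrs
        · simp [mulVec, dotProduct, Finset.sum_div]
        · simp [hrs, hrs.symm]
      have h2 : ∑ i, ∑ j, (if r = j then if s = j then D i j * h i / (2 * h j) else 0 else 0) =
          if r = s then (D *ᵥ h) r / (2 * h r) else 0 := by
        rcases eq_or_ne r s with rfl | hrs
        · simp [mulVec, dotProduct, Finset.sum_div, hsymm.apply r]
        · simp [hrs, hrs.symm]
      have h3 : ∀ a b : ι, ∑ i, ∑ j, (if a = i then if b = j then D i j / 2 else 0 else 0) =
          D a b / 2 := by
        intro a b
        rw [Finset.sum_comm]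
        simp
      rw [h1, h2, h3, h3, hsymm.apply r s]
      have := (hh r).ne'
      split_ifs <;> field_simp <;> ring
    rw [Matrix.add_apply, Matrix.add_apply, hsum, diagonal_apply, diagonal_apply]
    split_ifs <;> ring
  rw [hsplit]
  refine hB.add (diagonal fun i => ?_)
  rw [sub_nonneg, div_le_iff₀ (hh i), mul_comm]
  exact hle i

/-- Completely positive matrices `K` and `L` with the same value `T` of the quadratic form at `a`
are the diagonal blocks of a completely positive matrix whose kernel contains `(a, -a)`. -/
theorem fromBlocks_vecMulVec [Fintype ι] {K L : Matrix ι ι ℝ} (hK : IsCompletelyPositive K)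
    (hL : IsCompletelyPositive L) {a : ι → ℝ} (ha : ∀ i, 0 ≤ a i) {T : ℝ} (hT : 0 < T)
    (hKa : a ⬝ᵥ K *ᵥ a = T) (hLa : a ⬝ᵥ L *ᵥ a = T) :
    IsCompletelyPositive (fromBlocks K (T⁻¹ • vecMulVec (K *ᵥ a) (L *ᵥ a))
      (T⁻¹ • vecMulVec (L *ᵥ a) (K *ᵥ a)) L) := by
  obtain ⟨k, B, hB, rfl⟩ := hK
  obtain ⟨l, C, hC, rfl⟩ := hL
  set u := Bᵀ *ᵥ a with hu
  set v := Cᵀ *ᵥ a with hv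
  have hu0 : ∀ i, 0 ≤ u i := fun i => Finset.sum_nonneg fun j _ => mul_nonneg (hB _ _) (ha _)
  have hv0 : ∀ i, 0 ≤ v i := fun i => Finset.sum_nonneg fun j _ => mul_nonneg (hC _ _) (ha _)
  have huT : ∑ i, u i * u i = T := by
    rw [← hKa, ← mulVec_mulVec, dotProduct_mulVec, ← mulVec_transpose]; rfl
  have hvT : ∑ i, v i * v i = T := by
    rw [← hLa, ← mulVec_mulVec, dotProduct_mulVec, ← mulVec_transpose]; rfl
  obtain ⟨G, hGl, hGr⟩ : ∃ G : Matrix (ι ⊕ ι) (Fin k × Fin l) ℝ,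
      (∀ i p, G (Sum.inl i) p = (√T)⁻¹ * (B i p.1 * v p.2)) ∧
      ∀ i p, G (Sum.inr i) p = (√T)⁻¹ * (u p.1 * C i p.2) :=
    ⟨fun r p => (√T)⁻¹ * Sum.elim (fun i => B i p.1 * v p.2) (fun i => u p.1 * C i p.2) r,
      fun _ _ => rfl, fun _ _ => rfl⟩
  have hG : IsCompletelyPositive (G * Gᵀ) := mul_transpose G fun r p => by
    cases r
    · rw [hGl]
      exact mul_nonneg (by positivity) (mul_nonneg (hB _ _) (hv0 _))
    · rw [hGr]
      exact mul_nonneg (by positivity) (mul_nonneg (hu0 _) (hC _ _))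
  have hs : (√T)⁻¹ * (√T)⁻¹ = T⁻¹ := by rw [← mul_inv, Real.mul_self_sqrt hT.le]
  have key : ∀ (f f' : Fin k → ℝ) (g g' : Fin l → ℝ),
      ∑ p : Fin k × Fin l, ((√T)⁻¹ * (f p.1 * g p.2)) * ((√T)⁻¹ * (f' p.1 * g' p.2)) =
        T⁻¹ * ((∑ i, f i * f' i) * ∑ j, g j * g' j) := by
    intro f f' g g'
    rw [Finset.sum_mul_sum, Fintype.sum_prod_type, Finset.mul_sum]
    refine Finset.sum_congr rfl fun i _ => ?_
    rw [Finset.mul_sum]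
    refine Finset.sum_congr rfl fun j _ => ?_
    rw [← hs]
    ring
  convert hG using 1
  rw [← mulVec_mulVec, ← mulVec_mulVec, ← hu, ← hv]
  ext (r | r) (s | s) <;> rw [mul_apply] <;> simp only [transpose_apply, hGl, hGr]
  · rw [key (B r) (B s) v v, hvT, fromBlocks_apply₁₁, mul_apply]
    simp only [transpose_apply]
    field_simp
  · rw [key (B r) u v (C s)]
    simp only [fromBlocks_apply₁₂, Matrix.smul_apply, vecMulVec_apply, mulVec, dotProduct,
      smul_eq_mul, mul_comm (C s _)]
  · rw [key u (B s) (C r) v, mul_comm (∑ i, u i * B s i)]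
    simp only [fromBlocks_apply₂₁, Matrix.smul_apply, vecMulVec_apply, mulVec, dotProduct,
      smul_eq_mul, mul_comm (B s _)]
  · rw [key u u (C r) (C s), huT, fromBlocks_apply₂₂, mul_apply]
    simp only [transpose_apply]
    field_simp

end IsCompletelyPositive

/-- The points `x i`, their opposites, and the origin. -/
def symmetricPoints {ι : Type*} (x : ι → ℝ) : (ι ⊕ ι) ⊕ Unit → ℝ :=
  Sum.elim (Sum.elim x fun i => -x i) fun _ => 0

theorem isCompletelyPositive_symmetricPoints {ι : Type*} [Fintype ι] [DecidableEq ι] [Nonempty ι]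
    {x h : ι → ℝ} (hx : ∀ i, 0 < x i) (hh : ∀ i, 0 < h i)
    (hle : ∀ i, ∑ j, (x i - x j) ^ 2 * h j ≤ h i * (2 * ∑ j, x j ^ 2 - x i * ∑ j, x j)) :
    IsCompletelyPositive (Matrix.of fun s t =>
      (symmetricPoints x s - symmetricPoints x t) ^ 2 + if s = t then 4 * ∑ j, x j ^ 2 else 0) := by
  set S1 := ∑ j, x j with hS1
  set S2 := ∑ j, x j ^ 2 with hS2
  set S3 := ∑ j, x j ^ 3 with hS3
  have p1 : 0 < S1 := Finset.sum_pos (fun i _ => hx i) Finset.univ_nonempty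
  have p2 : 0 < S2 := Finset.sum_pos (fun i _ => pow_pos (hx i) 2) Finset.univ_nonempty
  have p3 : 0 < S3 := Finset.sum_pos (fun i _ => pow_pos (hx i) 3) Finset.univ_nonempty
  let D : Matrix ι ι ℝ := Matrix.of fun i j => (x i - x j) ^ 2
  let K := D + Matrix.diagonal fun i => 2 * S2 - x i * S1
  let L := Matrix.diagonal fun i => S1 * x i
  have hK : IsCompletelyPositive K := by
    exact .add_diagonal_of_mulVec_le (fun i j => sq_nonneg _)
      (IsSymm.ext fun i j => sub_sq_comm (x j) (x i)) hh hle
  have hL : IsCompletelyPositive L := .diagonal fun i => mul_nonneg p1.le (hx i).le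
  have hDx : ∀ i, (D *ᵥ x) i = x i ^ 2 * S1 - 2 * x i * S2 + S3 := by
    intro i
    simp only [hS1, hS2, hS3, mulVec, dotProduct, D, of_apply, Finset.mul_sum]
    rw [← Finset.sum_sub_distrib, ← Finset.sum_add_distrib]
    exact Finset.sum_congr rfl fun j _ => by ring
  have hKx : K *ᵥ x = fun _ => S3 := by
    ext i
    rw [add_mulVec, Pi.add_apply, hDx, mulVec_diagonal]
    ring
  have hLx : L *ᵥ x = fun i => S1 * x i ^ 2 := by
    ext i
    rw [mulVec_diagonal]
    ring
  have hKT : x ⬝ᵥ K *ᵥ x = S1 * S3 := by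
    rw [hKx, hS1, Finset.sum_mul]; rfl
  have hLT : x ⬝ᵥ L *ᵥ x = S1 * S3 := by
    rw [hLx, hS3, Finset.mul_sum]
    exact Finset.sum_congr rfl fun j _ => by ring
  have h1 := (hK.fromBlocks_vecMulVec hL (fun i => (hx i).le) (mul_pos p1 p3) hKT hLT)
  have h2 := (hL.fromBlocks_vecMulVec hK (fun i => (hx i).le) (mul_pos p1 p3) hLT hKT)
  obtain ⟨B, hBl, hBr, hBc⟩ : ∃ B : Matrix ((ι ⊕ ι) ⊕ Unit) (ι × ι) ℝ,
      (∀ i p, B (Sum.inl (Sum.inl i)) p = if i = p.1 then x p.2 else 0) ∧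
      (∀ i p, B (Sum.inl (Sum.inr i)) p = if i = p.2 then x p.1 else 0) ∧
      ∀ i p, B (Sum.inr i) p = if p.1 = p.2 then x p.1 / 2 else 0 :=
    ⟨fun s p => Sum.elim (Sum.elim (fun i => if i = p.1 then x p.2 else 0)
      fun i => if i = p.2 then x p.1 else 0) (fun _ => if p.1 = p.2 then x p.1 / 2 else 0) s,
      fun _ _ => rfl, fun _ _ => rfl, fun _ _ => rfl⟩
  have hB : IsCompletelyPositive (B * Bᵀ) := .mul_transpose B fun s p => by
    have := (hx p.1).le
    have := (hx p.2).le
    rcases s with (s | s) | s <;> simp only [hBl, hBr, hBc] <;> positivity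
  have hC : IsCompletelyPositive (Matrix.diagonal
      (Sum.elim (fun _ => 0) fun _ => 7 / 2 * S2 : (ι ⊕ ι) ⊕ Unit → ℝ)) :=
    .diagonal fun s => by rcases s with s | s <;> simp [p2.le]
  convert ((h1.add h2).fromBlocks_zero (κ := Unit)).add ((hB.add hB).add hC) using 1
  rw [hKx, hLx]
  ext ((s | s) | s) ((t | t) | t)
  all_goals
    simp [symmetricPoints, hBl, hBr, hBc, mul_apply, Fintype.sum_prod_type, K, L, D,
      diagonal_apply, vecMulVec]
  · split_ifs
    · simp only [← sq, ← hS2]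
      ring
    · ring
  · field_simp
    ring
  · ring
  · field_simp
    ring
  · split_ifs
    · simp only [← sq, ← hS2]
      ring
    · ring
  · ring
  · ring
  · ring
  · simp only [← sq, div_pow, ← Finset.sum_div, ← hS2]
    ring

theorem sum_add_pow_one (δ : ℝ) (m : ℕ) :
    ∑ j : Fin m, ((j : ℝ) + δ) = m * (m - 1) / 2 + m * δ := by
  induction m with
  | zero => simp
  | succ m ih =>
    rw [Fin.sum_univ_castSucc]
    simp only [Fin.val_castSucc, ih, Fin.val_last]
    push_cast
    ring

theorem sum_add_pow_two (δ : ℝ) (m : ℕ) :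
    ∑ j : Fin m, ((j : ℝ) + δ) ^ 2 =
      m * (m - 1) * (2 * m - 1) / 6 + m * (m - 1) * δ + m * δ ^ 2 := by
  induction m with
  | zero => simp
  | succ m ih =>
    rw [Fin.sum_univ_castSucc]
    simp only [Fin.val_castSucc, ih, Fin.val_last]
    push_cast
    ring

theorem sum_add_pow_three (δ : ℝ) (m : ℕ) :
    ∑ j : Fin m, ((j : ℝ) + δ) ^ 3 =
      (m * (m - 1) / 2) ^ 2 + m * (m - 1) * (2 * m - 1) / 2 * δ + 3 * m * (m - 1) / 2 * δ ^ 2 +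
        m * δ ^ 3 := by
  induction m with
  | zero => simp
  | succ m ih =>
    rw [Fin.sum_univ_castSucc]
    simp only [Fin.val_castSucc, ih, Fin.val_last]
    push_cast
    ring

theorem sum_add_pow_four (δ : ℝ) (m : ℕ) :
    ∑ j : Fin m, ((j : ℝ) + δ) ^ 4 =
      m * (m - 1) * (2 * m - 1) * (3 * m ^ 2 - 3 * m - 1) / 30 + m ^ 2 * (m - 1) ^ 2 * δ +
        m * (m - 1) * (2 * m - 1) * δ ^ 2 + 2 * m * (m - 1) * δ ^ 3 + m * δ ^ 4 := by
  induction m with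
  | zero => simp
  | succ m ih =>
    rw [Fin.sum_univ_castSucc]
    simp only [Fin.val_castSucc, ih, Fin.val_last]
    push_cast
    ring

theorem sum_sq_sub_mul_le {δ : ℝ} (hδ : δ = 1 / 2 ∨ δ = 1) {m : ℕ} (i : Fin m) :
    ∑ j : Fin m, (((i : ℝ) + δ) - (j + δ)) ^ 2 * (2 * m ^ 2 + 3 * ((j : ℝ) + δ) ^ 2) ≤
      (2 * m ^ 2 + 3 * ((i : ℝ) + δ) ^ 2) *
        (2 * ∑ j : Fin m, ((j : ℝ) + δ) ^ 2 - (i + δ) * ∑ j : Fin m, ((j : ℝ) + δ)) := by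
  have hexpand : ∀ a : ℝ,
      ∑ j : Fin m, (a - (j + δ)) ^ 2 * (2 * m ^ 2 + 3 * ((j : ℝ) + δ) ^ 2) =
        2 * m ^ 2 * (m * a ^ 2 - 2 * a * ∑ j : Fin m, ((j : ℝ) + δ) +
          ∑ j : Fin m, ((j : ℝ) + δ) ^ 2) +
        3 * (a ^ 2 * ∑ j : Fin m, ((j : ℝ) + δ) ^ 2 - 2 * a * ∑ j : Fin m, ((j : ℝ) + δ) ^ 3 +
          ∑ j : Fin m, ((j : ℝ) + δ) ^ 4) := by
    intro a
    have hm : (m : ℝ) * a ^ 2 = ∑ _j : Fin m, a ^ 2 := by simp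
    rw [hm]
    simp only [Finset.mul_sum, ← Finset.sum_sub_distrib, ← Finset.sum_add_distrib]
    exact Finset.sum_congr rfl fun j _ => by ring
  rw [hexpand, sum_add_pow_one, sum_add_pow_two, sum_add_pow_three, sum_add_pow_four]
  obtain ⟨k, hk⟩ := Nat.exists_eq_add_of_lt i.isLt
  have hm : (m : ℝ) = i + k + 1 := by exact_mod_cast hk
  rw [hm, ← sub_nonneg]
  generalize ((i : ℕ) : ℝ) = a, (i : ℕ).cast_nonneg (α := ℝ) = ha
  generalize (k : ℝ) = b, k.cast_nonneg (α := ℝ) = hb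
  rcases hδ with rfl | rfl <;> ring_nf <;> positivity

theorem isCompletelyPositive_of_mem_range {δ : ℝ} (hδ : δ = 1 / 2 ∨ δ = 1) {m : ℕ} (hm : 0 < m)
    {κ : Type*} [DecidableEq κ] {c : κ → ℝ} (hc : Function.Injective c)
    (hmem : ∀ i, c i ∈ Set.range (symmetricPoints fun j : Fin m => (j : ℝ) + δ)) :
    IsCompletelyPositive (Matrix.of fun i j =>
      (c i - c j) ^ 2 + if i = j then 4 * ∑ j : Fin m, ((j : ℝ) + δ) ^ 2 else 0) := by
  have : Nonempty (Fin m) := ⟨⟨0, hm⟩⟩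
  have hpos : 0 < δ := by rcases hδ with rfl | rfl <;> norm_num
  choose e he using hmem
  have hinj : Function.Injective e := fun i j hij => hc <| by rw [← he, ← he, hij]
  convert (isCompletelyPositive_symmetricPoints (x := fun j : Fin m => (j : ℝ) + δ)
    (fun i => by positivity) (fun i => by positivity) (sum_sq_sub_mul_le hδ)).submatrix e using 1
  ext i j
  simp [he, hinj.eq_iff]

theorem isCompletelyPositive_sq_sub_add_smul_one (n : ℕ) (hn : 1 ≤ n) :
    IsCompletelyPositive (Matrix.of (fun i j : Fin n => ((j : ℝ) - (i : ℝ)) ^ 2) +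
      ((n : ℝ) * ((n : ℝ) ^ 2 - 1) / 6) • (1 : Matrix (Fin n) (Fin n) ℝ)) := by
  obtain ⟨m, rfl | rfl⟩ := n.even_or_odd'
  · convert isCompletelyPositive_of_mem_range (δ := 1 / 2) (.inl rfl) (m := m) (by lia)
      (c := fun i : Fin (2 * m) => (m : ℝ) - 1 / 2 - (i : ℝ)) (fun i j hij => ?_) fun i => ?_ using 1
    · ext i j
      rw [sum_add_pow_two]
      simp only [Matrix.add_apply, Matrix.smul_apply, one_apply, of_apply, smul_eq_mul]
      split_ifs <;> push_cast <;> ring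
    · exact Fin.ext (by simpa using hij)
    · rcases lt_or_ge (i : ℕ) m with h | h
      · refine ⟨.inl (.inl ⟨m - 1 - i, by lia⟩), ?_⟩
        have : ((m - 1 - i : ℕ) : ℝ) = m - 1 - i := by
          rw [Nat.sub_sub, Nat.cast_sub (by lia)]; push_cast; ring
        simp only [symmetricPoints, Sum.elim_inl, this]
        ring
      · refine ⟨.inl (.inr ⟨i - m, by lia⟩), ?_⟩
        simp only [symmetricPoints, Sum.elim_inl, Sum.elim_inr, Nat.cast_sub h]
        ring
  · rcases m.eq_zero_or_pos with rfl | hm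
    · refine ⟨0, 0, fun _ _ => le_rfl, ?_⟩
      ext i j
      fin_cases i
      fin_cases j
      simp
    convert isCompletelyPositive_of_mem_range (δ := 1) (.inr rfl) hm
      (c := fun i : Fin (2 * m + 1) => (m : ℝ) - (i : ℝ)) (fun i j hij => ?_) fun i => ?_ using 1
    · ext i j
      rw [sum_add_pow_two]
      simp only [Matrix.add_apply, Matrix.smul_apply, one_apply, of_apply, smul_eq_mul]
      split_ifs <;> push_cast <;> ring
    · exact Fin.ext (by simpa using hij)
    · rcases lt_trichotomy (i : ℕ) m with h | h | h
      · refine ⟨.inl (.inl ⟨m - 1 - i, by lia⟩), ?_⟩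
        have : ((m - 1 - i : ℕ) : ℝ) = m - 1 - i := by
          rw [Nat.sub_sub, Nat.cast_sub (by lia)]; push_cast; ring
        simp only [symmetricPoints, Sum.elim_inl, this]
        ring
      · exact ⟨.inr (), by simp [symmetricPoints, h]⟩
      · refine ⟨.inl (.inr ⟨i - (m + 1), by lia⟩), ?_⟩
        simp only [symmetricPoints, Sum.elim_inl, Sum.elim_inr, Nat.cast_sub h]
        push_cast
        ring

theorem not_posSemidef_sq_sub_add_smul_one (n : ℕ) (hn : 1 ≤ n) {α : ℝ}
    (hα : α < (n : ℝ) * ((n : ℝ) ^ 2 - 1) / 6) :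
    ¬ (Matrix.of (fun i j : Fin n => ((j : ℝ) - (i : ℝ)) ^ 2) +
      α • (1 : Matrix (Fin n) (Fin n) ℝ)).PosSemidef := by
  intro h
  obtain rfl | hn := hn.eq_or_lt
  · have := h.diag_nonneg (i := 0)
    norm_num at this hα
    linarith
  let c : Fin n → ℝ := fun i => (i : ℝ) + -((n - 1) / 2)
  have hc1 : ∑ i, c i = 0 := by
    rw [sum_add_pow_one]
    ring
  have hc2 : ∑ i, c i ^ 2 = n * (n ^ 2 - 1) / 12 := by
    rw [sum_add_pow_two]
    ring
  have hMc : ∀ i, ((Matrix.of (fun i j : Fin n => ((j : ℝ) - (i : ℝ)) ^ 2) +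
      α • (1 : Matrix (Fin n) (Fin n) ℝ)) *ᵥ c) i =
        ∑ j, c j ^ 3 - 2 * c i * ∑ j, c j ^ 2 + c i ^ 2 * ∑ j, c j + α * c i := by
    intro i
    rw [add_mulVec, smul_mulVec, one_mulVec, Pi.add_apply, Pi.smul_apply, smul_eq_mul]
    congr 1
    simp only [mulVec, dotProduct, of_apply, Finset.mul_sum]
    rw [← Finset.sum_sub_distrib, ← Finset.sum_add_distrib]
    exact Finset.sum_congr rfl fun j _ => by simp only [c]; ring
  have hq := h.dotProduct_mulVec_nonneg c
  have hval : star c ⬝ᵥ ((Matrix.of (fun i j : Fin n => ((j : ℝ) - (i : ℝ)) ^ 2) +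
      α • (1 : Matrix (Fin n) (Fin n) ℝ)) *ᵥ c) =
        (∑ j, c j ^ 3) * ∑ i, c i + (α - 2 * ∑ j, c j ^ 2) * ∑ i, c i ^ 2 := by
    have hsum : ∀ p q : ℝ, ∑ i, c i * (p - 2 * c i * q + c i ^ 2 * 0 + α * c i) =
        p * ∑ i, c i + (α - 2 * q) * ∑ i, c i ^ 2 := by
      intro p q
      rw [Finset.mul_sum, Finset.mul_sum, ← Finset.sum_add_distrib]
      exact Finset.sum_congr rfl fun i _ => by ring
    rw [← hsum]
    simp only [dotProduct, hMc, star_trivial, hc1]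
  rw [hval, hc1, hc2, mul_zero, zero_add] at hq
  have hn' : (1 : ℝ) < n := by exact_mod_cast hn
  have hp : 0 < (n : ℝ) * (n ^ 2 - 1) / 12 := by
    have : (0 : ℝ) < n ^ 2 - 1 := by nlinarith
    positivity
  have := nonneg_of_mul_nonneg_left hq hp
  linarith

theorem stmt_14 (n : ℕ) (hn : 1 ≤ n)
    (A : Matrix (Fin n) (Fin n) ℝ)
    (hA : ∀ i j : Fin n, A i j = ((j.val : ℝ) - (i.val : ℝ)) ^ 2)
    (f : ℝ) (hf : f = (n : ℝ) * ((n : ℝ) ^ 2 - 1) / 6) :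
    (∃ (k : ℕ) (B : Matrix (Fin n) (Fin k) ℝ),
      (∀ (i : Fin n) (j : Fin k), 0 ≤ B i j) ∧
      A + f • (1 : Matrix (Fin n) (Fin n) ℝ) = B * Bᵀ) ∧
    (∀ α : ℝ, α < f →
      ¬ (A + α • (1 : Matrix (Fin n) (Fin n) ℝ)).PosSemidef) := by
  obtain rfl : A = Matrix.of fun i j : Fin n => ((j : ℝ) - (i : ℝ)) ^ 2 := by
    ext i j
    exact hA i j
  subst hf
  exact ⟨isCompletelyPositive_sq_sub_add_smul_one n hn,
    fun α hα => not_posSemidef_sq_sub_add_smul_one n hn hα⟩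
end

section
/- The 6×6 matrix B₆ = A₆ + 35·I₆ (with (A₆)_{ij} = (j-i)²) does not admit an integer completely positive factorization, i.e., there is no matrix U with nonnegative integer entries such that B₆ = UUᵀ. -/
open Matrix

/-- A vector isotropic for the Gram matrix `M * Mᵀ` is orthogonal to every column of `M`. -/
lemma vecMul_eq_zero_of_dotProduct_mul_transpose_mulVec_eq_zero {m n : Type*} [Fintype m]
    [Fintype n] (M : Matrix m n ℤ) (c : m → ℤ) (h : c ⬝ᵥ ((M * Mᵀ) *ᵥ c) = 0) :
    c ᵥ* M = 0 := by
  rw [← mulVec_mulVec, dotProduct_mulVec, mulVec_transpose] at h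
  exact dotProduct_self_eq_zero.1 h

/-- Constraints satisfied by a column `(a, b, t, d, e, f)` of a nonnegative integer factor: it is
orthogonal to the kernel vector `(-5, -3, -1, 1, 3, 5)`, and its products with the third entry are
bounded by the third row of the matrix. -/
lemma column_constraints {a b t d e f : ℤ} (ha : 0 ≤ a) (hb : 0 ≤ b) (ht : 0 ≤ t) (hd : 0 ≤ d)
    (he : 0 ≤ e) (hf : 0 ≤ f) (h : -5 * a - 3 * b - t + d + 3 * e + 5 * f = 0)
    (hta : t * a ≤ 4) (htb : t * b ≤ 1) (htt : t * t ≤ 35) (htd : t * d ≤ 1) (hte : t * e ≤ 4)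
    (htf : t * f ≤ 9) :
    t * t = 25 * (if t = 5 then 1 else 0) + 9 * (if t = 3 then 1 else 0)
        + (if t = 1 then 1 else 0) ∧
      3 * (if t = 3 then 1 else 0) + 2 * (if t = 1 then 1 else 0) ≤ t * e + 2 * (t * d) ∧
      t * a + 4 * (t * b) + 4 * (t * d) ≤ 3 * (e * f) + 8 * (if t = 1 then 1 else 0) := by
  have hef : 0 ≤ e * f := mul_nonneg he hf
  have ht5 : t ≤ 5 := by nlinarith
  interval_cases t
  · simp [hef]
  · refine ⟨by norm_num, ?_, ?_⟩
    · norm_num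
      have hb1 : b ≤ 1 := by omega
      interval_cases b <;> omega
    norm_num
    by_cases hbd : b = 1 ∧ d = 1
    · obtain ⟨rfl, rfl⟩ := hbd
      obtain rfl : e = 1 := by omega
      omega
    · omega
  · omega
  · obtain rfl : e = 1 := by omega
    norm_num
    omega
  · omega
  · norm_num
    omega

theorem stmt_15
    (B : Matrix (Fin 6) (Fin 6) ℤ)
    (hB : ∀ i j : Fin 6,
      B i j = ((j.val : ℤ) - (i.val : ℤ)) ^ 2 + if i = j then 35 else 0) :
    ¬ ∃ (k : ℕ) (U : Matrix (Fin 6) (Fin k) ℕ),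
        B = (U.map (fun x : ℕ => (x : ℤ))) * (U.map (fun x : ℕ => (x : ℤ)))ᵀ := by
  rintro ⟨k, U, hU⟩
  set M : Matrix (Fin 6) (Fin k) ℤ := U.map (fun x : ℕ => (x : ℤ)) with hM
  have hpos (i j) : 0 ≤ M i j := by simp [hM]
  have hsum (i i') : ∑ j, M i j * M i' j = B i i' := by simp [hU, mul_apply]
  have hle (i i') (j) : M i j * M i' j ≤ B i i' := by
    rw [← hsum]
    exact Finset.single_le_sum (f := fun j => M i j * M i' j)
      (fun j _ => mul_nonneg (hpos i j) (hpos i' j)) (Finset.mem_univ j)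
  have hker : ![-5, -3, -1, 1, 3, 5] ᵥ* M = 0 := by
    apply vecMul_eq_zero_of_dotProduct_mul_transpose_mulVec_eq_zero
    rw [← hU, show B = of fun i j : Fin 6 =>
      ((j.val : ℤ) - (i.val : ℤ)) ^ 2 + if i = j then 35 else 0 from Matrix.ext hB]
    decide
  have hcol (j) := column_constraints (hpos 0 j) (hpos 1 j) (hpos 2 j) (hpos 3 j) (hpos 4 j)
    (hpos 5 j)
    (by
      have : ∑ i, ![-5, -3, -1, 1, 3, 5] i * M i j = 0 := congrFun hker j
      rw [Fin.sum_univ_six] at this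
      change -5 * M 0 j + -3 * M 1 j + -1 * M 2 j + 1 * M 3 j + 3 * M 4 j + 5 * M 5 j = 0 at this
      linarith)
    (by simpa [hB] using hle 2 0 j) (by simpa [hB] using hle 2 1 j)
    (by simpa [hB] using hle 2 2 j) (by simpa [hB] using hle 2 3 j)
    (by simpa [hB] using hle 2 4 j) (by simpa [hB] using hle 2 5 j)
  have h₁ := Finset.sum_congr rfl fun j (_ : j ∈ Finset.univ) => (hcol j).1
  have h₂ := Finset.sum_le_sum fun j (_ : j ∈ Finset.univ) => (hcol j).2.1
  have h₃ := Finset.sum_le_sum fun j (_ : j ∈ Finset.univ) => (hcol j).2.2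
  simp only [Finset.sum_add_distrib, ← Finset.mul_sum, hsum, hB] at h₁ h₂ h₃
  have hcount (v : ℤ) : 0 ≤ ∑ j, if M 2 j = v then (1 : ℤ) else 0 :=
    Finset.sum_nonneg fun j _ => by split_ifs <;> norm_num
  have hn1 := hcount 1
  have hn3 := hcount 3
  have hn5 := hcount 5
  generalize (∑ j, if M 2 j = 1 then (1 : ℤ) else 0) = n₁ at *
  generalize (∑ j, if M 2 j = 3 then (1 : ℤ) else 0) = n₃ at *
  generalize (∑ j, if M 2 j = 5 then (1 : ℤ) else 0) = n₅ at *
  norm_num [Fin.ext_iff] at h₁ h₂ h₃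
  omega
end
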